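/- Let R be a common row type, τ a type of table names, and O an output type. Let Q1 = (L1, p1, π1) be an SPJ query under bag semantics with L1 nonempty, and let Q2 = (L2, p2, key, out) be an SPJA (grouping/aggregation, no HAVING) query, both with output type O. Then Q1 and Q2 cannot be equivalent under bag semantics if there exists some database instance for which Q1 returns a nonempty result; that is, if Q1(D) = Q2(D) for every instance D and there exists D with Q1(D) nonempty, a contradiction (False) follows. -/

import Mathlib

/-- The multiset of joined tuples: the multiset product of the tables
`D (L.get i)` for `i : Fin L.length`, with multiplicities multiplied. -/
def joined {R τ : Type*} (D : τ → Multiset R) :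
    (L : List τ) → Multiset (Fin L.length → R)
  | [] => {fun i => i.elim0}
  | T :: L' => (D T).bind (fun r => (joined D L').map (fun t => Fin.cons r t))

/-- The result of the SPJ query `(L, p, π)` under bag semantics on instance `D`. -/
def spjResult {R τ O : Type*} (L : List τ) (p : (Fin L.length → R) → Bool)
    (π : (Fin L.length → R) → O) (D : τ → Multiset R) : Multiset O :=
  ((joined D L).filter (fun t => p t = true)).map π

/-- The result of the SPJA query `(L, p, key, out)` (grouping/aggregation, no HAVING)
on instance `D`: one output row for each distinct key value occurring in the filtered
product `M`, applied to the sub-multiset of `M` with that key. -/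
def spjaResult {R τ O K : Type*} [DecidableEq K] (L : List τ)
    (p : (Fin L.length → R) → Bool) (key : (Fin L.length → R) → K)
    (out : K → Multiset (Fin L.length → R) → O) (D : τ → Multiset R) : Multiset O :=
  let M := (joined D L).filter (fun t => p t = true)
  ((M.map key).dedup).map (fun k => out k (M.filter (fun t => key t = k)))

theorem Multiset.nsmul_bind {α β : Type*} (k : ℕ) (s : Multiset α) (f : α → Multiset β) :
    (k • s).bind f = k • s.bind f := by
  induction k with
  | zero => simp
  | succ k ih => simp only [succ_nsmul, Multiset.add_bind, ih]

theorem Multiset.bind_nsmul {α β : Type*} (k : ℕ) (s : Multiset α) (f : α → Multiset β) :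
    s.bind (fun a => k • f a) = k • s.bind f := by
  induction k with
  | zero => simp
  | succ k ih => simp only [succ_nsmul, Multiset.bind_add, ih]

/-- Scaling every table by `n` scales the joined tuples by `n ^ L.length`. -/
theorem joined_nsmul {R τ : Type*} (n : ℕ) (D : τ → Multiset R) (L : List τ) :
    joined (fun T => n • D T) L = n ^ L.length • joined D L := by
  induction L with
  | nil => simp [joined]
  | cons T L ih =>
    simp only [joined, ih, Multiset.map_nsmul, Multiset.nsmul_bind,
      Multiset.bind_nsmul, List.length_cons, pow_succ, mul_smul]

theorem card_spjResult_nsmul {R τ O : Type*} (L : List τ) (p : (Fin L.length → R) → Bool)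
    (π : (Fin L.length → R) → O) (n : ℕ) (D : τ → Multiset R) :
    (spjResult L p π (fun T => n • D T)).card = n ^ L.length * (spjResult L p π D).card := by
  simp [spjResult, joined_nsmul, Multiset.filter_nsmul]

/-- The number of groups does not change when every table is scaled by a positive factor. -/
theorem card_spjaResult_nsmul {R τ O K : Type*} [DecidableEq K] (L : List τ)
    (p : (Fin L.length → R) → Bool) (key : (Fin L.length → R) → K)
    (out : K → Multiset (Fin L.length → R) → O) {n : ℕ} (hn : n ≠ 0) (D : τ → Multiset R) :
    (spjaResult L p key out (fun T => n • D T)).card = (spjaResult L p key out D).card := by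
  simp only [spjaResult, joined_nsmul, Multiset.filter_nsmul, Multiset.map_nsmul,
    Multiset.card_map, Multiset.dedup_nsmul (pow_ne_zero L.length hn)]

/-- An SPJ query (with nonempty FROM list) and an SPJA query cannot be equivalent
under bag semantics if the SPJ query returns a nonempty result on some instance. -/
theorem spj_not_equiv_spja {R τ O K : Type*} [DecidableEq K]
    (L1 : List τ) (hL1 : L1 ≠ [])
    (p1 : (Fin L1.length → R) → Bool) (π1 : (Fin L1.length → R) → O)
    (L2 : List τ)
    (p2 : (Fin L2.length → R) → Bool) (key : (Fin L2.length → R) → K)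
    (out : K → Multiset (Fin L2.length → R) → O)
    (hequiv : ∀ D : τ → Multiset R, spjResult L1 p1 π1 D = spjaResult L2 p2 key out D)
    (hne : ∃ D : τ → Multiset R, spjResult L1 p1 π1 D ≠ 0) :
    False := by
  obtain ⟨D, hD⟩ := hne
  have hcard := card_spjResult_nsmul L1 p1 π1 2 D
  rw [hequiv, card_spjaResult_nsmul L2 p2 key out two_ne_zero, ← hequiv] at hcard
  have hpos : 0 < (spjResult L1 p1 π1 D).card := Multiset.card_pos.mpr hD
  have hpow : 1 < 2 ^ L1.length :=
    Nat.one_lt_two_pow (mt List.length_eq_zero_iff.mp hL1)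
  nlinarith
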